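/- Let N ≥ 2 and let 𝔹^N be the open unit ball of ℝ^N. For every s ∈ (0,1), 𝔥_{s,1}(𝔹^N) ≤ [√π / (Γ(1−s/2)·Γ(1/2+s/2))] · [Γ((N+s)/2)/Γ((N−s)/2)] · [Γ(N−s)/Γ(N)] · 𝔥_{s,1}(ℍ^N_+). -/

import Mathlib

open MeasureTheory Metric Set Filter
open scoped ENNReal NNReal

/-- The `p`-th power of the Gagliardo `(s,p)`-seminorm of `u` on `A ⊆ ℝ^N`,
valued in `[0,∞]`. -/
noncomputable def gagliardo (N : ℕ) (s p : ℝ) (A : Set (EuclideanSpace ℝ (Fin N)))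
    (u : EuclideanSpace ℝ (Fin N) → ℝ) : ℝ≥0∞ :=
  ∫⁻ x in A, ∫⁻ y in A, ENNReal.ofReal (|u x - u y| ^ p / dist x y ^ ((N : ℝ) + s * p))

/-- The sharp fractional Hardy constant `𝔥_{s,p}(Ω)`, an element of `[0,∞]`. -/
noncomputable def hardyConst (N : ℕ) (s p : ℝ) (Ω : Set (EuclideanSpace ℝ (Fin N))) : ℝ≥0∞ :=
  sInf { c : ℝ≥0∞ | ∃ u : EuclideanSpace ℝ (Fin N) → ℝ,
    ContDiff ℝ (⊤ : ℕ∞) u ∧ HasCompactSupport u ∧ tsupport u ⊆ Ω ∧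
    (∫ x in Ω, |u x| ^ p / Metric.infDist x (frontier Ω) ^ (s * p)) = 1 ∧
    c = gagliardo N s p Set.univ u }

/-- The half-space `ℍ^N₊ = (0,∞) × ℝ^{N-1}`. -/
noncomputable def halfSpace (N : ℕ) (hN : 0 < N) : Set (EuclideanSpace ℝ (Fin N)) :=
  {x | 0 < x ⟨0, hN⟩}

lemma aux_polar {N : ℕ} (hN : 2 ≤ N) (f : EuclideanSpace ℝ (Fin N) → ℝ≥0∞) (hf : Measurable f) :
    ∫⁻ x, f x = ∫⁻ θ, (∫⁻ r in Ioi (0:ℝ), ENNReal.ofReal (r ^ (N - 1)) * f (r • (θ : EuclideanSpace ℝ (Fin N))))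
      ∂((volume : Measure (EuclideanSpace ℝ (Fin N))).toSphere) := by
  have : Nonempty (Fin N) := ⟨⟨0, by omega⟩⟩
  have : Nontrivial (EuclideanSpace ℝ (Fin N)) := by infer_instance
  have h1 : ∫⁻ x, f x = ∫⁻ x in ({0}ᶜ : Set (EuclideanSpace ℝ (Fin N))), f x := by
    rw [restrict_compl_singleton]
  rw [h1, ← lintegral_subtype_comap (measurableSet_singleton _).compl]
  have mp := (volume : Measure (EuclideanSpace ℝ (Fin N))).measurePreserving_homeomorphUnitSphereProd
  have h2 : (fun x : ({0}ᶜ : Set (EuclideanSpace ℝ (Fin N))) => f x)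
     = fun x => (fun p : sphere (0:EuclideanSpace ℝ (Fin N)) 1 × Ioi (0:ℝ) => f (p.2.1 • (p.1 : EuclideanSpace ℝ (Fin N))))
         (homeomorphUnitSphereProd _ x) := by
    funext x
    have : x.1 ≠ 0 := x.2
    simp [smul_smul, this]
  have hm : Measurable (fun p : sphere (0:EuclideanSpace ℝ (Fin N)) 1 × Ioi (0:ℝ) => f (p.2.1 • (p.1 : EuclideanSpace ℝ (Fin N)))) := by
    fun_prop
  rw [h2, mp.lintegral_comp hm, lintegral_prod _ hm.aemeasurable]
  refine lintegral_congr fun θ => ?_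
  rw [Measure.volumeIoiPow, lintegral_withDensity_eq_lintegral_mul _ (by fun_prop) (by fun_prop)]
  rw [← lintegral_subtype_comap measurableSet_Ioi]
  simp

lemma aux_gr (b : ℝ) (hb : -1 < b) :
    ∫⁻ r in Ioi (0:ℝ), ENNReal.ofReal r ^ b * ENNReal.ofReal (Real.exp (-r^2))
      = ENNReal.ofReal (Real.Gamma ((b+1)/2) / 2) := by
  have h := integral_rpow_mul_exp_neg_rpow (p := 2) (q := b) (by norm_num) hb
  rw [show Real.Gamma ((b+1)/2) / 2 = 1 / 2 * Real.Gamma ((b+1)/2) by ring, ← h,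
    ofReal_integral_eq_lintegral_ofReal (integrableOn_rpow_mul_exp_neg_rpow hb (by norm_num))]
  · refine setLIntegral_congr_fun measurableSet_Ioi fun r hr => ?_
    have hr' : 0 < r := hr
    rw [ENNReal.ofReal_rpow_of_pos hr', ← ENNReal.ofReal_mul (by positivity)]
    norm_num
  · filter_upwards [ae_restrict_mem measurableSet_Ioi] with r hr
    have hr' : 0 < r := hr
    positivity

lemma aux_pow (n : ℕ) (hn : 1 ≤ n) (r b : ℝ) (hr : 0 < r) :
    ENNReal.ofReal (r ^ (n - 1)) * ENNReal.ofReal r ^ b = ENNReal.ofReal r ^ ((n:ℝ) - 1 + b) := by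
  rw [ENNReal.ofReal_rpow_of_pos hr, ENNReal.ofReal_rpow_of_pos hr, ← ENNReal.ofReal_mul (by positivity),
    ← Real.rpow_natCast, ← Real.rpow_add hr]
  push_cast [hn]; rfl

lemma aux_int1 (b : ℝ) (hb : -1 < b) :
    ∫⁻ r in Ioo (0:ℝ) 1, ENNReal.ofReal r ^ b = ENNReal.ofReal (1 / (b+1)) := by
  have h := integral_rpow (a := 0) (b := 1) (r := b) (Or.inl hb)
  rw [intervalIntegral.integral_of_le (by norm_num)] at h
  have hi := (intervalIntegral.intervalIntegrable_rpow' (a := 0) (b := 1) hb).1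
  rw [show 1 / (b+1) = ((1:ℝ) ^ (b + 1) - 0 ^ (b + 1)) / (b + 1) by
    rw [Real.one_rpow, Real.zero_rpow (by linarith)]; ring, ← h,
    ofReal_integral_eq_lintegral_ofReal hi, restrict_Ioo_eq_restrict_Ioc]
  · refine setLIntegral_congr_fun measurableSet_Ioc fun r hr => ?_
    rw [ENNReal.ofReal_rpow_of_pos hr.1]
  · filter_upwards [ae_restrict_mem measurableSet_Ioc] with r hr
    have hr' : 0 < r := hr.1
    positivity

lemma aux_tail (s c : ℝ) (hs : 0 < s) (hc : 0 < c) :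
    ∫⁻ r in Ici c, ENNReal.ofReal r ^ (-1 - s) = ENNReal.ofReal (1 / s) * ENNReal.ofReal c ^ (-s) := by
  have h := integral_Ioi_rpow_of_lt (a := -1 - s) (by linarith) hc
  rw [ENNReal.ofReal_rpow_of_pos hc, ← ENNReal.ofReal_mul (by positivity)]
  rw [show 1 / s * c ^ (-s) = -c ^ (-1 - s + 1) / (-1 - s + 1) by
    rw [show -1 - s + 1 = -s by ring]; field_simp, ← h,
    ofReal_integral_eq_lintegral_ofReal (integrableOn_Ioi_rpow_of_lt (by linarith) hc), restrict_Ioi_eq_restrict_Ici]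
  · refine setLIntegral_congr_fun measurableSet_Ici fun r hr => ?_
    rw [ENNReal.ofReal_rpow_of_pos (lt_of_lt_of_le hc hr)]
  · filter_upwards [ae_restrict_mem measurableSet_Ioi] with r hr
    have hr' : 0 < r := hc.trans hr
    positivity

lemma aux_gauss1 (a : ℝ) (ha : -1 < a) :
    Integrable (fun t : ℝ => |t| ^ a * Real.exp (-t^2)) ∧
      ∫ t : ℝ, |t| ^ a * Real.exp (-t^2) = Real.Gamma ((a+1)/2) := by
  have h := integral_rpow_mul_exp_neg_rpow (p := 2) (q := a) (by norm_num) ha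
  have hi := integrableOn_rpow_mul_exp_neg_rpow (p := 2) (s := a) ha (by norm_num)
  have e : (fun t : ℝ => |t| ^ a * Real.exp (-t^2)) = fun t => (fun r : ℝ => r ^ a * Real.exp (-r^(2:ℝ))) |t| := by
    funext t; simp
  rw [e, integral_comp_abs (f := fun r : ℝ => r ^ a * Real.exp (-r^(2:ℝ))), h]
  refine ⟨?_, by ring⟩
  by_contra hc
  have h0 := integral_undef hc
  rw [integral_comp_abs (f := fun r : ℝ => r ^ a * Real.exp (-r^(2:ℝ))), h] at h0
  have := Real.Gamma_pos_of_pos (show 0 < (a+1)/2 by linarith)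
  linarith

lemma aux_gauss {N : ℕ} (hN : 2 ≤ N) (i0 : Fin N) (a : ℝ) (ha : -1 < a) :
    ∫⁻ y : EuclideanSpace ℝ (Fin N), ENNReal.ofReal |y i0| ^ a * ENNReal.ofReal (Real.exp (-‖y‖^2))
      = ENNReal.ofReal (Real.Gamma ((1+a)/2) * Real.pi ^ (((N:ℝ)-1)/2)) := by
  have hnull : ∀ᵐ y : EuclideanSpace ℝ (Fin N), y i0 ≠ 0 := by
    have := Measure.addHaar_submodule (volume : Measure (EuclideanSpace ℝ (Fin N)))
      (LinearMap.ker (EuclideanSpace.proj (𝕜 := ℝ) i0 : EuclideanSpace ℝ (Fin N) →L[ℝ] ℝ).toLinearMap) (by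
        intro h
        have : EuclideanSpace.single i0 (1:ℝ) ∈ (⊤ : Submodule ℝ (EuclideanSpace ℝ (Fin N))) := trivial
        rw [← h] at this
        simp at this)
    rw [ae_iff]
    convert this using 2
    ext y; simp
  have h1 : ∫⁻ y : EuclideanSpace ℝ (Fin N), ENNReal.ofReal |y i0| ^ a * ENNReal.ofReal (Real.exp (-‖y‖^2))
      = ∫⁻ y : EuclideanSpace ℝ (Fin N), ENNReal.ofReal (|y i0| ^ a * Real.exp (-‖y‖^2)) := by
    refine lintegral_congr_ae ?_
    filter_upwards [hnull] with y hy
    rw [ENNReal.ofReal_rpow_of_pos (abs_pos.2 hy), ← ENNReal.ofReal_mul (by positivity)]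
  let g : Fin N → ℝ → ℝ := fun i t => |t| ^ (if i = i0 then a else 0) * Real.exp (-t^2)
  have hg : ∀ z : Fin N → ℝ, |z i0| ^ a * Real.exp (-‖WithLp.toLp 2 z‖^2) = ∏ i, g i (z i) := by
    intro z
    simp only [g]
    rw [Finset.prod_mul_distrib, ← Real.exp_sum, EuclideanSpace.norm_sq_eq]
    congr 1
    · rw [Finset.prod_eq_single i0]
      · simp
      · intro b _ hb; simp [hb]
      · simp
    · simp
  have hgi : ∀ i, Integrable (g i) := fun i => (aux_gauss1 _ (by split_ifs <;> linarith)).1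
  rw [h1, ← (PiLp.volume_preserving_toLp (Fin N)).lintegral_comp_emb (MeasurableEquiv.toLp 2 _).measurableEmbedding]
  simp only [hg]
  rw [← ofReal_integral_eq_lintegral_ofReal]
  · rw [integral_fintype_prod_volume_eq_prod]
    congr 1
    simp only [g]
    have hh : ∀ i : Fin N, (-1:ℝ) < (if i = i0 then a else 0) := fun i => by split_ifs <;> linarith
    simp_rw [fun i => (aux_gauss1 _ (hh i)).2]
    rw [← Finset.mul_prod_erase _ _ (Finset.mem_univ i0)]
    congr 1
    · simp [add_comm]
    · rw [Finset.prod_congr rfl (g := fun _ => Real.sqrt Real.pi)]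
      · rw [Finset.prod_const, Finset.card_erase_of_mem (Finset.mem_univ _), Finset.card_fin, Real.sqrt_eq_rpow,
          ← Real.rpow_natCast, ← Real.rpow_mul Real.pi_pos.le]
        congr 1
        push_cast [show 1 ≤ N by omega]; ring
      · intro i hi
        rw [if_neg (Finset.ne_of_mem_erase hi)]
        rw [← Real.Gamma_one_half_eq]; norm_num
  · exact Integrable.fintype_prod (fun i => hgi i)
  · refine Eventually.of_forall fun z => Finset.prod_nonneg fun i _ => ?_
    simp only [g]; positivity

noncomputable def kk (N : ℕ) (s : ℝ) (h : EuclideanSpace ℝ (Fin N)) : ℝ≥0∞ :=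
  ENNReal.ofReal (1 / ‖h‖ ^ ((N:ℝ) + s))

lemma kk_meas (N : ℕ) (s : ℝ) : Measurable (kk N s) := by unfold kk; fun_prop

lemma kk_polar {N : ℕ} (hN : 2 ≤ N) (s r : ℝ) (hr : 0 < r) (θ : EuclideanSpace ℝ (Fin N)) (hθ : ‖θ‖ = 1) :
    ENNReal.ofReal (r ^ (N - 1)) * kk N s (r • θ) = ENNReal.ofReal r ^ (-1 - s) := by
  unfold kk
  rw [norm_smul, hθ, mul_one, Real.norm_of_nonneg hr.le, one_div, ← Real.rpow_neg hr.le,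
    ← ENNReal.ofReal_rpow_of_pos hr, aux_pow N (by omega) r _ hr]
  congr 1; ring

lemma aux_S1 {N : ℕ} (hN : 2 ≤ N) (x : EuclideanSpace ℝ (Fin N)) (b : ℝ) (hb : -(N:ℝ) < b) :
    ∫⁻ y : EuclideanSpace ℝ (Fin N), ENNReal.ofReal |inner ℝ x y| ^ b * ENNReal.ofReal (Real.exp (-‖y‖^2))
     = (∫⁻ θ, ENNReal.ofReal |inner ℝ x (θ : EuclideanSpace ℝ (Fin N))| ^ b
      ∂((volume : Measure (EuclideanSpace ℝ (Fin N))).toSphere)) * ENNReal.ofReal (Real.Gamma (((N:ℝ) + b)/2) / 2) := by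
  rw [aux_polar hN _ (by fun_prop), ← lintegral_mul_const _ (by fun_prop)]
  refine lintegral_congr fun θ => ?_
  have hθ : ‖(θ : EuclideanSpace ℝ (Fin N))‖ = 1 := by simp
  have := aux_gr ((N:ℝ) - 1 + b) (by linarith)
  rw [show ((N:ℝ) + b)/2 = ((N:ℝ) - 1 + b + 1)/2 by ring, ← this, ← lintegral_const_mul _ (by fun_prop)]
  refine setLIntegral_congr_fun measurableSet_Ioi fun r hr => ?_
  have hr' : 0 < r := hr
  simp only [norm_smul, hθ, inner_smul_right, abs_mul, abs_of_pos hr', Real.norm_of_nonneg hr'.le, mul_one]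
  rw [← aux_pow N (by omega) r b hr', ENNReal.ofReal_mul hr'.le, ENNReal.mul_rpow_of_ne_top (by finiteness) (by finiteness)]
  ring

lemma aux_S2 {N : ℕ} (hN : 2 ≤ N) (s : ℝ) (hs : 0 < s) (x : EuclideanSpace ℝ (Fin N)) :
    ∫⁻ h in {h : EuclideanSpace ℝ (Fin N) | |inner ℝ x h| ≤ ‖h‖^2/2}, kk N s h
     ≤ ENNReal.ofReal (2 ^ (-s) / s) * ∫⁻ θ, ENNReal.ofReal |inner ℝ x (θ : EuclideanSpace ℝ (Fin N))| ^ (-s)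
      ∂((volume : Measure (EuclideanSpace ℝ (Fin N))).toSphere) := by
  have hms : MeasurableSet {h : EuclideanSpace ℝ (Fin N) | |inner ℝ x h| ≤ ‖h‖^2/2} :=
    measurableSet_le (by fun_prop) (by fun_prop)
  rw [← lintegral_indicator hms, aux_polar hN _ ((kk_meas N s).indicator hms),
    ← lintegral_const_mul _ (by fun_prop)]
  refine lintegral_mono fun θ => ?_
  have hθ : ‖(θ : EuclideanSpace ℝ (Fin N))‖ = 1 := by simp
  rcases eq_or_ne (inner ℝ x (θ : EuclideanSpace ℝ (Fin N))) 0 with hc | hc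
  · simp only [hc, abs_zero, ENNReal.ofReal_zero]
    rw [ENNReal.zero_rpow_of_neg (by linarith), ENNReal.mul_top]
    · exact le_top
    · have : 0 < (2:ℝ) ^ (-s) / s := by positivity
      simpa using this
  · have hc' : 0 < 2 * |inner ℝ x (θ : EuclideanSpace ℝ (Fin N))| := by positivity
    have := aux_tail s _ hs hc'
    rw [ENNReal.ofReal_mul (by norm_num), ENNReal.mul_rpow_of_ne_top (by finiteness) (by finiteness),
      ENNReal.ofReal_rpow_of_pos (by norm_num), ← mul_assoc, ← ENNReal.ofReal_mul (by positivity)] at this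
    rw [show (2:ℝ) ^ (-s) / s = 1 / s * 2 ^ (-s) by ring, ← this,
      ← lintegral_indicator measurableSet_Ici, ← lintegral_indicator measurableSet_Ioi]
    refine lintegral_mono fun r => ?_
    by_cases hr : r ∈ Ioi (0:ℝ)
    · have hr' : 0 < r := hr
      rw [indicator_of_mem hr]
      by_cases hm : r • (θ : EuclideanSpace ℝ (Fin N)) ∈ {h : EuclideanSpace ℝ (Fin N) | |inner ℝ x h| ≤ ‖h‖^2/2}
      · have hm' : r ∈ Ici (2 * |inner ℝ x (θ : EuclideanSpace ℝ (Fin N))|) := by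
          simp only [mem_ofPred_eq, norm_smul, hθ, inner_smul_right, abs_mul, abs_of_pos hr', Real.norm_of_nonneg hr'.le, mul_one] at hm
          simp only [mem_Ici]
          nlinarith
        rw [indicator_of_mem hm', indicator_of_mem hm, kk_polar hN s r hr' _ hθ]
      · rw [indicator_of_notMem hm]; simp
    · rw [indicator_of_notMem hr]; simp

lemma aux_S3 {N : ℕ} (hN : 2 ≤ N) (s a : ℝ) (hs : 0 < s) (ha : 0 < a) (x : EuclideanSpace ℝ (Fin N)) :
    ENNReal.ofReal (1 / s) * ENNReal.ofReal a ^ (-s) * ∫⁻ θ, ENNReal.ofReal |inner ℝ x (θ : EuclideanSpace ℝ (Fin N))| ^ s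
      ∂((volume : Measure (EuclideanSpace ℝ (Fin N))).toSphere) ≤
    ∫⁻ h in {h : EuclideanSpace ℝ (Fin N) | a ≤ |inner ℝ x h|}, kk N s h := by
  have hms : MeasurableSet {h : EuclideanSpace ℝ (Fin N) | a ≤ |inner ℝ x h|} :=
    measurableSet_le (by fun_prop) (by fun_prop)
  rw [← lintegral_indicator hms, aux_polar hN _ ((kk_meas N s).indicator hms),
    ← lintegral_const_mul _ (by fun_prop)]
  refine lintegral_mono fun θ => ?_
  have hθ : ‖(θ : EuclideanSpace ℝ (Fin N))‖ = 1 := by simp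
  rcases eq_or_ne (inner ℝ x (θ : EuclideanSpace ℝ (Fin N))) 0 with hc | hc
  · simp only [hc, abs_zero, ENNReal.ofReal_zero]
    rw [ENNReal.zero_rpow_of_pos (by linarith), mul_zero]
    exact zero_le
  · have hc' : 0 < |inner ℝ x (θ : EuclideanSpace ℝ (Fin N))| := by positivity
    have hq : 0 < a / |inner ℝ x (θ : EuclideanSpace ℝ (Fin N))| := by positivity
    have := aux_tail s _ hs hq
    have e : ENNReal.ofReal (1 / s) * ENNReal.ofReal a ^ (-s) * ENNReal.ofReal |inner ℝ x (θ : EuclideanSpace ℝ (Fin N))| ^ s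
      = ENNReal.ofReal (1 / s) * ENNReal.ofReal (a / |inner ℝ x (θ : EuclideanSpace ℝ (Fin N))|) ^ (-s) := by
      rw [ENNReal.ofReal_rpow_of_pos ha, ENNReal.ofReal_rpow_of_pos hc', ENNReal.ofReal_rpow_of_pos hq, mul_assoc, ← ENNReal.ofReal_mul (by positivity),
        Real.div_rpow ha.le hc'.le, Real.rpow_neg hc'.le, div_inv_eq_mul]
    rw [e, ← this,
      ← lintegral_indicator measurableSet_Ici, ← lintegral_indicator measurableSet_Ioi]
    refine lintegral_mono fun r => ?_
    by_cases hr : r ∈ Ici (a / |inner ℝ x (θ : EuclideanSpace ℝ (Fin N))|)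
    · have hr' : 0 < r := lt_of_lt_of_le hq hr
      rw [indicator_of_mem hr, indicator_of_mem (show r ∈ Ioi (0:ℝ) from hr')]
      rw [indicator_of_mem, kk_polar hN s r hr' _ hθ]
      simp only [mem_ofPred_eq, inner_smul_right, abs_mul, abs_of_pos hr']
      rwa [mem_Ici, div_le_iff₀ hc'] at hr
    · rw [indicator_of_notMem hr]; exact zero_le

lemma aux_R {N : ℕ} (hN : 2 ≤ N) (x : EuclideanSpace ℝ (Fin N)) (b : ℝ) (hb : -1 < b) :
    ∫⁻ y : EuclideanSpace ℝ (Fin N), ENNReal.ofReal |inner ℝ x y| ^ b * ENNReal.ofReal (Real.exp (-‖y‖^2))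
     = ENNReal.ofReal ‖x‖ ^ b * ENNReal.ofReal (Real.Gamma ((1+b)/2) * Real.pi ^ (((N:ℝ)-1)/2)) := by
  let i0 : Fin N := ⟨0, by omega⟩
  let w : EuclideanSpace ℝ (Fin N) := ‖x‖ • EuclideanSpace.single i0 (1:ℝ)
  have hw : ‖x‖ = ‖w‖ := by simp [w, norm_smul]
  let R := Submodule.reflection (ℝ ∙ (w - x))ᗮ
  have hR : R w = x := Submodule.reflection_sub hw.symm
  rw [← aux_gauss hN i0 b hb, ← lintegral_const_mul _ (by fun_prop),
    ← (LinearIsometryEquiv.measurePreserving R).lintegral_comp_emb R.toHomeomorph.measurableEmbedding]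
  refine lintegral_congr fun y => ?_
  have h1 : inner ℝ x (R y) = ‖x‖ * y i0 := by
    rw [← hR, LinearIsometryEquiv.inner_map_map R, hR]
    simp [w, inner_smul_left, EuclideanSpace.inner_single_left]
  rw [h1, abs_mul, abs_norm, ENNReal.ofReal_mul (norm_nonneg _), ENNReal.mul_rpow_of_ne_top (by finiteness) (by finiteness), LinearIsometryEquiv.norm_map, mul_assoc]

lemma aux_A {N : ℕ} (hN : 2 ≤ N) (x : EuclideanSpace ℝ (Fin N)) (b : ℝ) (hb : -1 < b) :
    ∫⁻ θ, ENNReal.ofReal |inner ℝ x (θ : EuclideanSpace ℝ (Fin N))| ^ b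
      ∂((volume : Measure (EuclideanSpace ℝ (Fin N))).toSphere) =
    ENNReal.ofReal ‖x‖ ^ b * ENNReal.ofReal (2 * Real.Gamma ((1+b)/2) * Real.pi ^ (((N:ℝ)-1)/2) / Real.Gamma (((N:ℝ) + b)/2)) := by
  have hN' : (2:ℝ) ≤ N := by exact_mod_cast hN
  have h1 := aux_S1 hN x b (by linarith)
  rw [aux_R hN x b hb] at h1
  have hG : 0 < Real.Gamma (((N:ℝ) + b)/2) := Real.Gamma_pos_of_pos (by linarith)
  have hG' : 0 < Real.Gamma ((1 + b)/2) := Real.Gamma_pos_of_pos (by linarith)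
  have hp := Real.pi_pos
  have e : ENNReal.ofReal (2 * Real.Gamma ((1+b)/2) * Real.pi ^ (((N:ℝ)-1)/2) / Real.Gamma (((N:ℝ) + b)/2))
    = ENNReal.ofReal (Real.Gamma ((1+b)/2) * Real.pi ^ (((N:ℝ)-1)/2)) / ENNReal.ofReal (Real.Gamma (((N:ℝ) + b)/2) / 2) := by
    rw [← ENNReal.ofReal_div_of_pos (by positivity)]
    congr 1
    field_simp
  rw [e, ← mul_div_assoc, h1, ENNReal.mul_div_cancel_right]
  · have : 0 < Real.Gamma (((N:ℝ) + b)/2) / 2 := by positivity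
    simpa using this
  · finiteness

lemma gag_eq {N : ℕ} (s : ℝ) (u : EuclideanSpace ℝ (Fin N) → ℝ) (hu : Continuous u) :
    gagliardo N s 1 univ u = ∫⁻ h, kk N s h * ∫⁻ x, ENNReal.ofReal |u (x + h) - u x| := by
  have hm : Measurable (fun p : EuclideanSpace ℝ (Fin N) × EuclideanSpace ℝ (Fin N) =>
     kk N s p.1 * ENNReal.ofReal |u (p.2 + p.1) - u p.2|) := by
    have := kk_meas N s
    have := hu.measurable
    fun_prop
  have e : ∀ h, kk N s h * ∫⁻ x, ENNReal.ofReal |u (x + h) - u x| =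
     ∫⁻ x, kk N s h * ENNReal.ofReal |u (x + h) - u x| := by
    intro h
    rw [lintegral_const_mul]
    have := hu.measurable
    fun_prop
  simp_rw [e]
  rw [lintegral_lintegral_swap hm.aemeasurable]
  unfold gagliardo
  simp only [Measure.restrict_univ]
  refine lintegral_congr fun x => ?_
  rw [← lintegral_add_left_eq_self _ x]
  refine lintegral_congr fun h => ?_
  unfold kk
  rw [← ENNReal.ofReal_mul (by positivity), Real.rpow_one, mul_one, dist_self_add_right, abs_sub_comm]
  congr 1
  ring

lemma trans_set {N : ℕ} (f : EuclideanSpace ℝ (Fin N) → ℝ≥0∞) (A : Set (EuclideanSpace ℝ (Fin N)))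
    (_hA : MeasurableSet A) (h : EuclideanSpace ℝ (Fin N)) :
    ∫⁻ x in (fun x => x + h) ⁻¹' A, f (x + h) = ∫⁻ x in A, f x :=
  (measurePreserving_add_right volume h).setLIntegral_comp_preimage_emb
    (MeasurableEquiv.addRight h).measurableEmbedding f A

lemma low_h {N : ℕ} (i0 : Fin N) (u : EuclideanSpace ℝ (Fin N) → ℝ) (hu : Continuous u)
    (hc : HasCompactSupport u) (hpos : ∀ x, x i0 ≤ 0 → u x = 0) (h : EuclideanSpace ℝ (Fin N)) (hh : 0 ≤ h i0) :
    2 * ∫⁻ x in {x | x i0 ≤ h i0}, ENNReal.ofReal |u x| ≤ ∫⁻ x, ENNReal.ofReal |u (x + h) - u x| := by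
  have hum := hu.measurable
  have hfin : ∫⁻ x, ENNReal.ofReal |u x| ≠ ∞ := by
    have := (hu.integrable_of_hasCompactSupport (μ := volume) hc).abs
    rw [← ofReal_integral_eq_lintegral_ofReal this (Eventually.of_forall fun x => abs_nonneg _)]
    finiteness
  have hm0 : MeasurableSet {x : EuclideanSpace ℝ (Fin N) | x i0 ≤ 0} := measurableSet_le (by fun_prop) (by fun_prop)
  have hmh : MeasurableSet {x : EuclideanSpace ℝ (Fin N) | x i0 ≤ h i0} := measurableSet_le (by fun_prop) (by fun_prop)
  rw [← lintegral_add_compl (fun x => ENNReal.ofReal |u (x + h) - u x|) hm0, two_mul]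
  refine add_le_add ?_ ?_
  · rw [← trans_set _ _ hmh h]
    have : (fun x => x + h) ⁻¹' {x : EuclideanSpace ℝ (Fin N) | x i0 ≤ h i0} = {x | x i0 ≤ 0} := by
      ext x; simp
    rw [this]
    refine setLIntegral_mono' hm0 fun x hx => ?_
    rw [hpos x hx, sub_zero]
  · have h1 : ∫⁻ x, ENNReal.ofReal |u x| = ∫⁻ x in {x : EuclideanSpace ℝ (Fin N) | x i0 ≤ 0}ᶜ, ENNReal.ofReal |u x| := by
      rw [← lintegral_add_compl _ hm0, setLIntegral_congr_fun (g := fun _ => 0) hm0]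
      · simp
      · intro x hx
        simp [hpos x hx]
    have h2 : ∫⁻ x in {x : EuclideanSpace ℝ (Fin N) | x i0 ≤ 0}ᶜ, ENNReal.ofReal |u (x + h)|
       = ∫⁻ x in {x : EuclideanSpace ℝ (Fin N) | x i0 ≤ h i0}ᶜ, ENNReal.ofReal |u x| := by
      rw [← trans_set _ _ hmh.compl h]
      congr 2
      ext x; simp
    have h3 : ∫⁻ x in {x : EuclideanSpace ℝ (Fin N) | x i0 ≤ 0}ᶜ, ENNReal.ofReal |u x| ≤
        (∫⁻ x in {x : EuclideanSpace ℝ (Fin N) | x i0 ≤ 0}ᶜ, ENNReal.ofReal |u (x + h) - u x|)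
        + ∫⁻ x in {x : EuclideanSpace ℝ (Fin N) | x i0 ≤ 0}ᶜ, ENNReal.ofReal |u (x + h)| := by
      rw [← lintegral_add_left (by fun_prop)]
      refine lintegral_mono fun x => ?_
      rw [← ENNReal.ofReal_add (abs_nonneg _) (abs_nonneg _)]
      refine ENNReal.ofReal_le_ofReal ?_
      have := abs_sub (u (x+h)) (u (x + h) - u x)
      simp only [sub_sub_cancel] at this
      linarith
    rw [h2, ← h1, ← lintegral_add_compl _ hmh] at h3
    refine (ENNReal.add_le_add_iff_right ?_).1 h3
    exact ne_top_of_le_ne_top hfin (setLIntegral_le_lintegral _ _)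

lemma low_h' {N : ℕ} (i0 : Fin N) (u : EuclideanSpace ℝ (Fin N) → ℝ) (hu : Continuous u)
    (hc : HasCompactSupport u) (hpos : ∀ x, x i0 ≤ 0 → u x = 0) (h : EuclideanSpace ℝ (Fin N)) :
    2 * ∫⁻ x in {x | x i0 ≤ |h i0|}, ENNReal.ofReal |u x| ≤ ∫⁻ x, ENNReal.ofReal |u (x + h) - u x| := by
  rcases le_total 0 (h i0) with hh | hh
  · rw [abs_of_nonneg hh]; exact low_h i0 u hu hc hpos h hh
  · rw [abs_of_nonpos hh]
    have := low_h i0 u hu hc hpos (-h) (by simpa using hh)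
    refine this.trans ?_
    rw [← lintegral_add_right_eq_self _ h]
    refine lintegral_mono fun x => ?_
    rw [add_neg_cancel_right, abs_sub_comm]

lemma low {N : ℕ} (hN : 2 ≤ N) (i0 : Fin N) (s : ℝ) (hs : 0 < s) (u : EuclideanSpace ℝ (Fin N) → ℝ) (hu : Continuous u)
    (hc : HasCompactSupport u) (hpos : ∀ x, x i0 ≤ 0 → u x = 0) :
    ENNReal.ofReal (4 * Real.Gamma ((1+s)/2) * Real.pi ^ (((N:ℝ)-1)/2) / (s * Real.Gamma (((N:ℝ) + s)/2))) *
      ∫⁻ x in {x : EuclideanSpace ℝ (Fin N) | 0 < x i0}, ENNReal.ofReal |u x| * ENNReal.ofReal (x i0) ^ (-s)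
    ≤ gagliardo N s 1 univ u := by
  have hum := hu.measurable
  have hkm := kk_meas N s
  rw [gag_eq s u hu]
  have hp := Real.pi_pos
  have hN' : (2:ℝ) ≤ N := by exact_mod_cast hN
  have hG : 0 < Real.Gamma (((N:ℝ) + s)/2) := Real.Gamma_pos_of_pos (by linarith)
  have hG' : 0 < Real.Gamma ((1 + s)/2) := Real.Gamma_pos_of_pos (by linarith)
  have hmp : MeasurableSet {x : EuclideanSpace ℝ (Fin N) | 0 < x i0} := measurableSet_lt (by fun_prop) (by fun_prop)
  let T : Set (EuclideanSpace ℝ (Fin N) × EuclideanSpace ℝ (Fin N)) := {p | p.2 i0 ≤ |p.1 i0|}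
  have hT : MeasurableSet T := measurableSet_le (by fun_prop) (by fun_prop)
  let F : EuclideanSpace ℝ (Fin N) × EuclideanSpace ℝ (Fin N) → ℝ≥0∞ :=
    T.indicator fun p => kk N s p.1 * (2 * ENNReal.ofReal |u p.2|)
  have hF : Measurable F := Measurable.indicator (by fun_prop) hT
  calc _ ≤ ∫⁻ x in {x : EuclideanSpace ℝ (Fin N) | 0 < x i0}, ∫⁻ h, F (h, x) := by
        rw [← lintegral_const_mul _ (by fun_prop)]
        refine setLIntegral_mono' hmp fun x hx => ?_
        have h3 := aux_S3 hN s (x i0) hs hx (EuclideanSpace.single i0 (1:ℝ))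
        rw [aux_A hN _ s (by linarith)] at h3
        have hms : MeasurableSet {h : EuclideanSpace ℝ (Fin N) | x i0 ≤ |inner ℝ (EuclideanSpace.single i0 (1:ℝ)) h|} :=
          measurableSet_le (by fun_prop) (by fun_prop)
        have e1 : ∫⁻ h, F (h, x) = (2 * ENNReal.ofReal |u x|) * ∫⁻ h in {h : EuclideanSpace ℝ (Fin N) | x i0 ≤ |inner ℝ (EuclideanSpace.single i0 (1:ℝ)) h|}, kk N s h := by
          rw [← lintegral_const_mul _ hkm, ← lintegral_indicator hms]
          refine lintegral_congr fun h => ?_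
          simp only [F, T, indicator, mem_ofPred_eq, EuclideanSpace.inner_single_left, map_one, one_mul, mul_comm]
        rw [e1]
        refine le_trans (le_of_eq ?_) (mul_le_mul_right h3 (2 * ENNReal.ofReal |u x|))
        have hx' : 0 < x i0 := hx
        rw [show ‖EuclideanSpace.single i0 (1:ℝ)‖ = 1 by simp, ENNReal.ofReal_one, ENNReal.one_rpow, one_mul, ENNReal.ofReal_rpow_of_pos hx',
          show 2 * ENNReal.ofReal |u x| = ENNReal.ofReal (2 * |u x|) by
            rw [ENNReal.ofReal_mul (by norm_num), ENNReal.ofReal_ofNat]]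
        rw [← ENNReal.ofReal_mul (by positivity), ← ENNReal.ofReal_mul (by positivity),
           ← ENNReal.ofReal_mul (by positivity), ← ENNReal.ofReal_mul (by positivity), ← ENNReal.ofReal_mul (by positivity)]
        congr 1
        field_simp
        ring
    _ ≤ ∫⁻ x, ∫⁻ h, F (h, x) := setLIntegral_le_lintegral _ _
    _ = ∫⁻ h, ∫⁻ x, F (h, x) := by
        exact (lintegral_lintegral_swap (f := fun h x => F (h, x)) hF.aemeasurable).symm
    _ ≤ _ := by
        refine lintegral_mono fun h => ?_
        refine le_trans (le_of_eq ?_) (mul_le_mul_right (low_h' i0 u hu hc hpos h) (kk N s h))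
        have hms : MeasurableSet {x : EuclideanSpace ℝ (Fin N) | x i0 ≤ |h i0|} :=
          measurableSet_le (by fun_prop) (by fun_prop)
        rw [← lintegral_const_mul _ (by fun_prop), ← lintegral_const_mul _ (by fun_prop), ← lintegral_indicator hms]
        rfl

lemma up_half {N : ℕ} (u : EuclideanSpace ℝ (Fin N) → ℝ) (hu : Continuous u)
    (hanti : ∀ x y, ‖x‖ ≤ ‖y‖ → u y ≤ u x) (h0 : ∀ x, 0 ≤ u x) (h1 : ∀ x, u x ≤ 1)
    (hout : ∀ x, x ∉ ball (0 : EuclideanSpace ℝ (Fin N)) 1 → u x = 0) (h : EuclideanSpace ℝ (Fin N)) :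
    ∫⁻ x in {x | 0 ≤ inner ℝ x h}, ENNReal.ofReal |u (x + (1/2:ℝ) • h) - u (x - (1/2:ℝ) • h)|
     ≤ volume (ball (0 : EuclideanSpace ℝ (Fin N)) 1 ∩ {x | |inner ℝ x h| ≤ ‖h‖^2/2}) := by
  have hum := hu.measurable
  have hub : ∀ x, ENNReal.ofReal (u x) ≤ (ball (0 : EuclideanSpace ℝ (Fin N)) 1).indicator 1 x := by
    intro x
    by_cases hx : x ∈ ball (0 : EuclideanSpace ℝ (Fin N)) 1
    · rw [indicator_of_mem hx]; simpa using h1 x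
    · rw [hout x hx]; simp
  have hfin : ∫⁻ x, ENNReal.ofReal (u x) ≠ ∞ := by
    refine ne_top_of_le_ne_top ?_ (lintegral_mono hub)
    rw [lintegral_indicator_one measurableSet_ball]
    exact measure_ball_lt_top.ne
  have mS : ∀ c : ℝ, MeasurableSet {x : EuclideanSpace ℝ (Fin N) | c ≤ inner ℝ x h} := fun c =>
    measurableSet_le (by fun_prop) (by fun_prop)
  have key : (∫⁻ x in {x | 0 ≤ inner ℝ x h}, ENNReal.ofReal |u (x + (1/2:ℝ) • h) - u (x - (1/2:ℝ) • h)|)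
     + ∫⁻ x in {x | 0 ≤ inner ℝ x h}, ENNReal.ofReal (u (x + (1/2:ℝ) • h)) =
     ∫⁻ x in {x | 0 ≤ inner ℝ x h}, ENNReal.ofReal (u (x - (1/2:ℝ) • h)) := by
    rw [← lintegral_add_left (by fun_prop)]
    refine setLIntegral_congr_fun (mS 0) fun x hx => ?_
    have hx' : 0 ≤ inner ℝ x h := hx
    have hn : ‖x - (1/2:ℝ) • h‖ ≤ ‖x + (1/2:ℝ) • h‖ := by
      rw [← sq_le_sq₀ (norm_nonneg _) (norm_nonneg _), @norm_sub_sq_real, @norm_add_sq_real, inner_smul_right]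
      linarith
    have := hanti _ _ hn
    beta_reduce
    rw [← ENNReal.ofReal_add (abs_nonneg _) (h0 _), abs_of_nonpos (by linarith)]
    congr 1; ring
  have hhh : inner ℝ h h = ‖h‖^2 := real_inner_self_eq_norm_sq h
  have t1 : ∫⁻ x in {x | 0 ≤ inner ℝ x h}, ENNReal.ofReal (u (x + (1/2:ℝ) • h)) =
     ∫⁻ x in {x | ‖h‖^2/2 ≤ inner ℝ x h}, ENNReal.ofReal (u x) := by
    rw [← trans_set _ _ (mS (‖h‖^2/2)) ((1/2:ℝ) • h)]
    congr 2
    ext x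
    simp only [mem_preimage, mem_ofPred_eq, inner_add_left, inner_smul_left, hhh]
    simp
    constructor <;> intro <;> linarith
  have t2 : ∫⁻ x in {x | 0 ≤ inner ℝ x h}, ENNReal.ofReal (u (x - (1/2:ℝ) • h)) =
     ∫⁻ x in {x | -(‖h‖^2/2) ≤ inner ℝ x h}, ENNReal.ofReal (u x) := by
    rw [← trans_set _ _ (mS (-(‖h‖^2/2))) (-((1/2:ℝ) • h))]
    simp only [← sub_eq_add_neg]
    congr 2
    ext x
    simp only [mem_preimage, mem_ofPred_eq, inner_sub_left, inner_smul_left, hhh]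
    simp
    constructor <;> intro <;> linarith
  have t3 : ∫⁻ x in {x | -(‖h‖^2/2) ≤ inner ℝ x h}, ENNReal.ofReal (u x) ≤
     (∫⁻ x in {x | |inner ℝ x h| ≤ ‖h‖^2/2}, ENNReal.ofReal (u x)) +
     ∫⁻ x in {x | ‖h‖^2/2 ≤ inner ℝ x h}, ENNReal.ofReal (u x) := by
    refine le_trans (lintegral_mono_set ?_) (lintegral_union_le _ _ _)
    intro x hx
    simp only [mem_union, mem_ofPred_eq] at hx ⊢
    by_cases hq : ‖h‖^2/2 ≤ inner ℝ x h
    · exact Or.inr hq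
    · left; rw [abs_le]; constructor <;> linarith
  rw [t1, t2] at key
  rw [← key] at t3
  have t4 := (ENNReal.add_le_add_iff_right (ne_top_of_le_ne_top hfin (setLIntegral_le_lintegral _ _))).1 t3
  refine t4.trans ?_
  refine (lintegral_mono hub).trans ?_
  rw [lintegral_indicator_one measurableSet_ball, Measure.restrict_apply measurableSet_ball]

lemma up_h {N : ℕ} (u : EuclideanSpace ℝ (Fin N) → ℝ) (hu : Continuous u)
    (hanti : ∀ x y, ‖x‖ ≤ ‖y‖ → u y ≤ u x) (h0 : ∀ x, 0 ≤ u x) (h1 : ∀ x, u x ≤ 1)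
    (hout : ∀ x, x ∉ ball (0 : EuclideanSpace ℝ (Fin N)) 1 → u x = 0) (h : EuclideanSpace ℝ (Fin N)) :
    ∫⁻ x, ENNReal.ofReal |u (x + h) - u x|
     ≤ 2 * volume (ball (0 : EuclideanSpace ℝ (Fin N)) 1 ∩ {x | |inner ℝ x h| ≤ ‖h‖^2/2}) := by
  have a := up_half u hu hanti h0 h1 hout h
  have b := up_half u hu hanti h0 h1 hout (-h)
  have e : ∫⁻ x, ENNReal.ofReal |u (x + h) - u x| =
     ∫⁻ x, ENNReal.ofReal |u (x + (1/2:ℝ) • h) - u (x - (1/2:ℝ) • h)| := by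
    rw [← lintegral_sub_right_eq_self _ ((1/2:ℝ) • h)]
    refine lintegral_congr fun x => ?_
    congr 4
    module
  rw [e, two_mul, ← setLIntegral_univ]
  simp only [inner_neg_right, abs_neg, norm_neg, smul_neg, sub_neg_eq_add, ← sub_eq_add_neg] at b
  have hsub : (univ : Set (EuclideanSpace ℝ (Fin N))) ⊆ {x | 0 ≤ inner ℝ x h} ∪ {x | 0 ≤ - inner ℝ x h} := by
    intro x _
    simp only [mem_union, mem_ofPred_eq]
    rcases le_total 0 (inner ℝ x h) with q | q
    · exact Or.inl q
    · right; linarith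
  refine (lintegral_mono_set hsub).trans ((lintegral_union_le _ _ _).trans (add_le_add a ?_))
  refine le_trans (le_of_eq ?_) b
  refine lintegral_congr fun x => ?_
  rw [abs_sub_comm]

lemma ball_pow {N : ℕ} (hN : 2 ≤ N) (s : ℝ) (hs1 : s < 1) :
    ∫⁻ x in ball (0 : EuclideanSpace ℝ (Fin N)) 1, ENNReal.ofReal ‖x‖ ^ (-s)
     = ENNReal.ofReal (1 / ((N:ℝ) - s)) * (volume : Measure (EuclideanSpace ℝ (Fin N))).toSphere univ := by
  have hN' : (2:ℝ) ≤ N := by exact_mod_cast hN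
  rw [← lintegral_indicator measurableSet_ball, aux_polar hN _ (Measurable.indicator (by fun_prop) measurableSet_ball)]
  rw [← lintegral_const]
  refine lintegral_congr fun θ => ?_
  have hθ : ‖(θ : EuclideanSpace ℝ (Fin N))‖ = 1 := by simp
  rw [show (N:ℝ) - s = (N:ℝ) - 1 + -s + 1 by ring, ← aux_int1 _ (by linarith),
    ← lintegral_indicator measurableSet_Ioi, ← lintegral_indicator measurableSet_Ioo]
  refine lintegral_congr fun r => ?_
  by_cases hr : 0 < r
  · rw [indicator_of_mem (show r ∈ Ioi (0:ℝ) from hr)]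
    by_cases hr1 : r < 1
    · rw [indicator_of_mem (show r ∈ Ioo (0:ℝ) 1 from ⟨hr, hr1⟩), indicator_of_mem, ← aux_pow N (by omega) r _ hr,
        norm_smul, hθ, mul_one, Real.norm_of_nonneg hr.le]
      simpa [norm_smul, hθ, abs_of_pos hr] using hr1
    · rw [indicator_of_notMem, indicator_of_notMem, mul_zero]
      · simp [hr1]
      · simpa [norm_smul, hθ, abs_of_pos hr] using hr1
  · rw [indicator_of_notMem, indicator_of_notMem] <;> simp [hr]

lemma ball_D {N : ℕ} (hN : 2 ≤ N) (s : ℝ) (hs1 : s < 1) :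
    ∫⁻ x in ball (0 : EuclideanSpace ℝ (Fin N)) 1, ENNReal.ofReal ((1 - ‖x‖) ^ (-s))
     = ENNReal.ofReal (ProbabilityTheory.beta N (1 - s)) * (volume : Measure (EuclideanSpace ℝ (Fin N))).toSphere univ := by
  have hN' : (2:ℝ) ≤ N := by exact_mod_cast hN
  have hb := ProbabilityTheory.lintegral_betaPDF_eq_one (α := N) (β := 1 - s) (by linarith) (by linarith)
  have hbp := ProbabilityTheory.beta_pos (α := N) (β := 1 - s) (by linarith) (by linarith)
  rw [ProbabilityTheory.lintegral_betaPDF] at hb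
  have hb' : ∫⁻ r in Ioo (0:ℝ) 1, ENNReal.ofReal (r ^ (N - 1)) * ENNReal.ofReal ((1 - r) ^ (-s)) = ENNReal.ofReal (ProbabilityTheory.beta N (1 - s)) := by
    rw [← mul_one (ENNReal.ofReal _), ← hb, ← lintegral_const_mul _ (by fun_prop)]
    refine setLIntegral_congr_fun measurableSet_Ioo fun r hr => ?_
    have h1r : 0 < 1 - r := by linarith [hr.2]
    beta_reduce
    rw [← ENNReal.ofReal_mul (pow_nonneg hr.1.le _), ← ENNReal.ofReal_mul hbp.le, ← Real.rpow_natCast]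
    congr 1
    push_cast [show 1 ≤ N by omega]
    rw [show 1 - s - 1 = -s by ring]
    field_simp
  rw [← lintegral_indicator measurableSet_ball, aux_polar hN _ (Measurable.indicator (by fun_prop) measurableSet_ball)]
  rw [← lintegral_const]
  refine lintegral_congr fun θ => ?_
  have hθ : ‖(θ : EuclideanSpace ℝ (Fin N))‖ = 1 := by simp
  rw [← hb', ← lintegral_indicator measurableSet_Ioi, ← lintegral_indicator measurableSet_Ioo]
  refine lintegral_congr fun r => ?_
  by_cases hr : 0 < r
  · rw [indicator_of_mem (show r ∈ Ioi (0:ℝ) from hr)]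
    by_cases hr1 : r < 1
    · rw [indicator_of_mem (show r ∈ Ioo (0:ℝ) 1 from ⟨hr, hr1⟩), indicator_of_mem,
        norm_smul, hθ, mul_one, Real.norm_of_nonneg hr.le]
      simpa [norm_smul, hθ, abs_of_pos hr] using hr1
    · rw [indicator_of_notMem, indicator_of_notMem, mul_zero]
      · simp [hr1]
      · simpa [norm_smul, hθ, abs_of_pos hr] using hr1
  · rw [indicator_of_notMem, indicator_of_notMem] <;> simp [hr]

lemma up {N : ℕ} (hN : 2 ≤ N) (s : ℝ) (hs : 0 < s) (hs1 : s < 1) (u : EuclideanSpace ℝ (Fin N) → ℝ) (hu : Continuous u)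
    (hanti : ∀ x y, ‖x‖ ≤ ‖y‖ → u y ≤ u x) (h0 : ∀ x, 0 ≤ u x) (h1 : ∀ x, u x ≤ 1)
    (hout : ∀ x, x ∉ ball (0 : EuclideanSpace ℝ (Fin N)) 1 → u x = 0) :
    gagliardo N s 1 univ u ≤
      ENNReal.ofReal (4 * 2 ^ (-s) / s * Real.Gamma ((1-s)/2) * Real.pi ^ (((N:ℝ)-1)/2) / (((N:ℝ) - s) * Real.Gamma (((N:ℝ) - s)/2))) *
      (volume : Measure (EuclideanSpace ℝ (Fin N))).toSphere univ := by
  have hkm := kk_meas N s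
  have hp := Real.pi_pos
  have hN' : (2:ℝ) ≤ N := by exact_mod_cast hN
  have hNs : 0 < (N:ℝ) - s := by linarith
  have hG : 0 < Real.Gamma (((N:ℝ) - s)/2) := Real.Gamma_pos_of_pos (by linarith)
  have hG' : 0 < Real.Gamma ((1 - s)/2) := Real.Gamma_pos_of_pos (by linarith)
  rw [gag_eq s u hu]
  let T : Set (EuclideanSpace ℝ (Fin N) × EuclideanSpace ℝ (Fin N)) := {p | |inner ℝ p.2 p.1| ≤ ‖p.1‖^2/2}
  have hT : MeasurableSet T := measurableSet_le (by fun_prop) (by fun_prop)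
  let F : EuclideanSpace ℝ (Fin N) × EuclideanSpace ℝ (Fin N) → ℝ≥0∞ :=
    T.indicator fun p => kk N s p.1 * 2
  have hF : Measurable F := Measurable.indicator (by fun_prop) hT
  calc _ ≤ ∫⁻ h, ∫⁻ x in ball (0 : EuclideanSpace ℝ (Fin N)) 1, F (h, x) := by
        refine lintegral_mono fun h => ?_
        refine le_trans (mul_le_mul_right (up_h u hu hanti h0 h1 hout h) (kk N s h)) (le_of_eq ?_)
        have hms : MeasurableSet {x : EuclideanSpace ℝ (Fin N) | |inner ℝ x h| ≤ ‖h‖^2/2} :=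
          measurableSet_le (by fun_prop) (by fun_prop)
        have e : (fun x => F (h, x)) = {x : EuclideanSpace ℝ (Fin N) | |inner ℝ x h| ≤ ‖h‖^2/2}.indicator fun _ => kk N s h * 2 := rfl
        rw [e, lintegral_indicator_const hms, Measure.restrict_apply hms, inter_comm, mul_assoc]
    _ = ∫⁻ x in ball (0 : EuclideanSpace ℝ (Fin N)) 1, ∫⁻ h, F (h, x) :=
        lintegral_lintegral_swap (f := fun h x => F (h, x)) hF.aemeasurable
    _ ≤ ∫⁻ x in ball (0 : EuclideanSpace ℝ (Fin N)) 1, ENNReal.ofReal (2 * (2 ^ (-s) / s) * (2 * Real.Gamma ((1+-s)/2) * Real.pi ^ (((N:ℝ)-1)/2) / Real.Gamma (((N:ℝ) + -s)/2))) * ENNReal.ofReal ‖x‖ ^ (-s) := by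
        refine lintegral_mono fun x => ?_
        have hms : MeasurableSet {h : EuclideanSpace ℝ (Fin N) | |inner ℝ x h| ≤ ‖h‖^2/2} :=
          measurableSet_le (by fun_prop) (by fun_prop)
        have e : (fun h => F (h, x)) = {h : EuclideanSpace ℝ (Fin N) | |inner ℝ x h| ≤ ‖h‖^2/2}.indicator fun h => kk N s h * 2 := rfl
        rw [e, lintegral_indicator hms, lintegral_mul_const _ hkm, mul_comm]
        refine le_trans (mul_le_mul_right (aux_S2 hN s hs x) 2) (le_of_eq ?_)
        rw [aux_A hN x (-s) (by linarith), ENNReal.ofReal_mul (by positivity), ENNReal.ofReal_mul (p := 2) (by positivity), ENNReal.ofReal_ofNat]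
        ring
    _ = _ := by
        rw [lintegral_const_mul _ (by fun_prop), ball_pow hN s hs1, ← mul_assoc]
        simp only [← sub_eq_add_neg]
        rw [← ENNReal.ofReal_mul (by positivity)]
        congr 2
        field_simp
        ring

lemma half_low {N : ℕ} (hN : 2 ≤ N) (hN0 : 0 < N) (s : ℝ) (hs : 0 < s) :
    ENNReal.ofReal (4 * Real.Gamma ((1+s)/2) * Real.pi ^ (((N:ℝ)-1)/2) / (s * Real.Gamma (((N:ℝ) + s)/2)))
      ≤ hardyConst N s 1 (halfSpace N hN0) := by
  unfold hardyConst
  refine le_sInf ?_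
  rintro c ⟨u, hu, hc, hsup, hint, rfl⟩
  have hpos : ∀ x : EuclideanSpace ℝ (Fin N), x ⟨0, hN0⟩ ≤ 0 → u x = 0 := by
    intro x hx
    by_contra hne
    have : x ∈ halfSpace N hN0 := hsup (subset_tsupport u hne)
    have h' : 0 < x ⟨0, hN0⟩ := this
    linarith
  refine le_trans ?_ (low hN ⟨0, hN0⟩ s hs u hu.continuous hc hpos)
  refine le_mul_of_one_le_right zero_le ?_
  have hopen : IsOpen (halfSpace N hN0) := isOpen_lt continuous_const (by fun_prop)
  have hi : Integrable (fun x => |u x| ^ (1:ℝ) / Metric.infDist x (frontier (halfSpace N hN0)) ^ (s * 1)) (volume.restrict (halfSpace N hN0)) := by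
    by_contra hcon
    rw [integral_undef hcon] at hint
    norm_num at hint
  have h1 : (1:ℝ≥0∞) = ∫⁻ x in halfSpace N hN0, ENNReal.ofReal (|u x| ^ (1:ℝ) / Metric.infDist x (frontier (halfSpace N hN0)) ^ (s * 1)) := by
    rw [← ofReal_integral_eq_lintegral_ofReal hi, hint, ENNReal.ofReal_one]
    refine Eventually.of_forall fun x => ?_
    have := Metric.infDist_nonneg (x := x) (s := frontier (halfSpace N hN0))
    positivity
  rw [h1]
  refine setLIntegral_mono' hopen.measurableSet fun x hx => ?_
  have hx' : 0 < x ⟨0, hN0⟩ := hx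
  rw [ENNReal.ofReal_rpow_of_pos hx', ← ENNReal.ofReal_mul (abs_nonneg _), Real.rpow_one, mul_one]
  refine ENNReal.ofReal_le_ofReal ?_
  rcases (frontier (halfSpace N hN0)).eq_empty_or_nonempty with he | hne
  · rw [he, Metric.infDist_empty, Real.zero_rpow hs.ne', div_zero]
    positivity
  · have hd : x ⟨0, hN0⟩ ≤ Metric.infDist x (frontier (halfSpace N hN0)) := by
      rw [Metric.le_infDist hne]
      intro y hy
      have hy0 : y ⟨0, hN0⟩ ≤ 0 := by
        have : y ∉ halfSpace N hN0 := by
          rw [hopen.frontier_eq] at hy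
          exact hy.2
        exact not_lt.1 this
      have := EuclideanSpace.norm_eq (x - y)
      have h2 : |(x - y) ⟨0, hN0⟩| ≤ ‖x - y‖ := PiLp.norm_apply_le (x - y) ⟨0, hN0⟩
      rw [dist_eq_norm]
      have h3 := le_abs_self ((x - y) ⟨0, hN0⟩)
      have h4 : (x - y) ⟨0, hN0⟩ = x ⟨0, hN0⟩ - y ⟨0, hN0⟩ := rfl
      linarith
    rw [Real.rpow_neg hx'.le, div_eq_mul_inv]
    gcongr

lemma infDist_ball {N : ℕ} (hN : 2 ≤ N) (x : EuclideanSpace ℝ (Fin N)) (hx : x ∈ ball (0 : EuclideanSpace ℝ (Fin N)) 1) :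
    Metric.infDist x (frontier (ball (0 : EuclideanSpace ℝ (Fin N)) 1)) = 1 - ‖x‖ := by
  have : Nonempty (Fin N) := ⟨⟨0, by omega⟩⟩
  have : Nontrivial (EuclideanSpace ℝ (Fin N)) := by infer_instance
  rw [frontier_ball _ one_ne_zero]
  have hx1 : ‖x‖ < 1 := by simpa using hx
  apply le_antisymm
  · rcases eq_or_ne x 0 with rfl | h0
    · obtain ⟨y, hy⟩ := NormedSpace.sphere_nonempty (E := EuclideanSpace ℝ (Fin N)) (x := 0) (r := 1) |>.2 zero_le_one
      refine (Metric.infDist_le_dist_of_mem hy).trans ?_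
      have : ‖y‖ = 1 := by simpa using hy
      simp [this]
    · have hn : 0 < ‖x‖ := norm_pos_iff.2 h0
      have hy : ‖x‖⁻¹ • x ∈ sphere (0 : EuclideanSpace ℝ (Fin N)) 1 := by
        simp [norm_smul, hn.ne']
      refine (Metric.infDist_le_dist_of_mem hy).trans ?_
      rw [dist_eq_norm, show x - ‖x‖⁻¹ • x = (1 - ‖x‖⁻¹) • x by module, norm_smul, Real.norm_eq_abs]
      have : 1 ≤ ‖x‖⁻¹ := (one_le_inv₀ hn).2 hx1.le
      rw [abs_of_nonpos (by linarith)]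
      field_simp
      linarith
  · rw [Metric.le_infDist (NormedSpace.sphere_nonempty.2 zero_le_one)]
    intro y hy
    have : ‖y‖ = 1 := by simpa using hy
    rw [dist_comm, dist_eq_norm]
    have := norm_sub_norm_le y x
    linarith

noncomputable def uu (N n : ℕ) (x : EuclideanSpace ℝ (Fin N)) : ℝ :=
  Real.smoothTransition (n * (1 - ‖x‖^2) - 1)

lemma uu_contDiff (N n : ℕ) : ContDiff ℝ (⊤ : ℕ∞) (uu N n) := by
  unfold uu
  exact Real.smoothTransition.contDiff.comp
    ((contDiff_const.mul (contDiff_const.sub (contDiff_norm_sq ℝ))).sub contDiff_const)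

lemma uu_tsupport (N n : ℕ) : tsupport (uu N n) ⊆ ball 0 1 := by
  have h1 : tsupport (uu N n) ⊆ {x | 1 ≤ (n:ℝ) * (1 - ‖x‖^2)} := by
    refine closure_minimal ?_ (isClosed_le (by fun_prop) (by fun_prop))
    intro x hx
    by_contra hcon
    simp only [mem_ofPred_eq, not_le] at hcon
    exact hx (Real.smoothTransition.zero_of_nonpos (by linarith))
  refine h1.trans fun x hx => ?_
  simp only [mem_ofPred_eq] at hx
  rw [mem_ball_zero_iff]
  by_contra hcon
  have hn : (0:ℝ) ≤ n := Nat.cast_nonneg n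
  have h3 : 1 ≤ ‖x‖ := not_lt.1 hcon
  have h4 : 1 - ‖x‖^2 ≤ 0 := by nlinarith
  have h5 := mul_nonpos_of_nonneg_of_nonpos hn h4
  linarith

lemma ball_test {N : ℕ} (hN : 2 ≤ N) (s : ℝ) (hs : 0 < s) (hs1 : s < 1) (n : ℕ) :
    hardyConst N s 1 (ball 0 1) * (∫⁻ x in ball (0 : EuclideanSpace ℝ (Fin N)) 1, ENNReal.ofReal (uu N n x) * ENNReal.ofReal ((1 - ‖x‖) ^ (-s)))
    ≤ ENNReal.ofReal (4 * 2 ^ (-s) / s * Real.Gamma ((1-s)/2) * Real.pi ^ (((N:ℝ)-1)/2) / (((N:ℝ) - s) * Real.Gamma (((N:ℝ) - s)/2))) *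
      (volume : Measure (EuclideanSpace ℝ (Fin N))).toSphere univ := by
  have hcont := (uu_contDiff N n).continuous
  have hum := hcont.measurable
  have h0 : ∀ x, 0 ≤ uu N n x := fun x => Real.smoothTransition.nonneg _
  have h1 : ∀ x, uu N n x ≤ 1 := fun x => Real.smoothTransition.le_one _
  have hup := up hN s hs hs1 (uu N n) hcont (fun x y hxy => Real.smoothTransition.monotone (by gcongr)) h0 h1
    (fun x hx => by
      by_contra hne
      exact hx (uu_tsupport N n (subset_tsupport _ hne)))
  refine le_trans ?_ hup
  set I := ∫⁻ x in ball (0 : EuclideanSpace ℝ (Fin N)) 1, ENNReal.ofReal (uu N n x) * ENNReal.ofReal ((1 - ‖x‖) ^ (-s)) with hI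
  have hIfin : I ≠ ∞ := by
    refine ne_top_of_le_ne_top (b := ENNReal.ofReal (ProbabilityTheory.beta N (1 - s)) * (volume : Measure (EuclideanSpace ℝ (Fin N))).toSphere univ) (by finiteness) ?_
    rw [← ball_D hN s hs1]
    refine lintegral_mono fun x => ?_
    refine mul_le_of_le_one_left zero_le ?_
    simpa using h1 x
  rcases eq_or_ne I 0 with h | hI0
  · rw [h]; simp
  have hd : 0 < I.toReal := ENNReal.toReal_pos hI0 hIfin
  set d := I.toReal with hd_def
  have hId : I = ENNReal.ofReal d := (ENNReal.ofReal_toReal hIfin).symm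
  have hmem : hardyConst N s 1 (ball 0 1) ≤ gagliardo N s 1 univ (fun x => d⁻¹ * uu N n x) := by
    unfold hardyConst
    refine sInf_le ⟨_, contDiff_const.mul (uu_contDiff N n), ?_, ?_, ?_, rfl⟩
    · have hk : IsCompact (tsupport (uu N n)) :=
        (isCompact_closedBall (0 : EuclideanSpace ℝ (Fin N)) 1).of_isClosed_subset (isClosed_tsupport _)
          ((uu_tsupport N n).trans ball_subset_closedBall)
      exact HasCompactSupport.mul_left hk
    · exact (tsupport_mul_subset_right).trans (uu_tsupport N n)
    · rw [integral_eq_lintegral_of_nonneg_ae]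
      · have : ∫⁻ x in ball (0 : EuclideanSpace ℝ (Fin N)) 1, ENNReal.ofReal (|d⁻¹ * uu N n x| ^ (1:ℝ) / Metric.infDist x (frontier (ball (0 : EuclideanSpace ℝ (Fin N)) 1)) ^ (s * 1))
           = ENNReal.ofReal d⁻¹ * I := by
          rw [hI, ← lintegral_const_mul _ (by fun_prop)]
          refine setLIntegral_congr_fun measurableSet_ball fun x hx => ?_
          have hx1 : ‖x‖ < 1 := by simpa using hx
          have hx2 : 0 < 1 - ‖x‖ := by linarith
          beta_reduce
          rw [infDist_ball hN x hx, Real.rpow_one, mul_one, abs_of_nonneg (mul_nonneg (by positivity) (h0 x)),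
            ← ENNReal.ofReal_mul (h0 x), ← ENNReal.ofReal_mul (by positivity), Real.rpow_neg hx2.le, div_eq_mul_inv, mul_assoc]
        rw [this, hId, ← ENNReal.ofReal_mul (by positivity), inv_mul_cancel₀ hd.ne']
        simp
      · refine Eventually.of_forall fun x => ?_
        have := Metric.infDist_nonneg (x := x) (s := frontier (ball (0 : EuclideanSpace ℝ (Fin N)) 1))
        positivity
      · have := Metric.continuous_infDist_pt (frontier (ball (0 : EuclideanSpace ℝ (Fin N)) 1))
        have := this.measurable
        exact Measurable.aestronglyMeasurable (by fun_prop)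
  have hsc : gagliardo N s 1 univ (fun x => d⁻¹ * uu N n x) = ENNReal.ofReal d⁻¹ * gagliardo N s 1 univ (uu N n) := by
    rw [gag_eq s _ (by fun_prop), gag_eq s _ hcont, ← lintegral_const_mul']
    · refine lintegral_congr fun h => ?_
      rw [mul_left_comm, ← lintegral_const_mul' (ENNReal.ofReal d⁻¹) _ (by finiteness)]
      congr 1
      refine lintegral_congr fun x => ?_
      rw [← ENNReal.ofReal_mul (by positivity), ← mul_sub, abs_mul, abs_of_pos (by positivity)]
    · finiteness
  calc _ ≤ (ENNReal.ofReal d⁻¹ * gagliardo N s 1 univ (uu N n)) * ENNReal.ofReal d := by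
        rw [hId, ← hsc]
        exact mul_le_mul_left hmem _
    _ = _ := by
        rw [mul_right_comm, ← ENNReal.ofReal_mul (by positivity), inv_mul_cancel₀ hd.ne', ENNReal.ofReal_one, one_mul]

lemma ball_up {N : ℕ} (hN : 2 ≤ N) (s : ℝ) (hs : 0 < s) (hs1 : s < 1) :
    hardyConst N s 1 (ball 0 1) * (∫⁻ x in ball (0 : EuclideanSpace ℝ (Fin N)) 1, ENNReal.ofReal ((1 - ‖x‖) ^ (-s)))
    ≤ ENNReal.ofReal (4 * 2 ^ (-s) / s * Real.Gamma ((1-s)/2) * Real.pi ^ (((N:ℝ)-1)/2) / (((N:ℝ) - s) * Real.Gamma (((N:ℝ) - s)/2))) *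
      (volume : Measure (EuclideanSpace ℝ (Fin N))).toSphere univ := by
  have : Nonempty (Fin N) := ⟨⟨0, by omega⟩⟩
  have : Nontrivial (EuclideanSpace ℝ (Fin N)) := by infer_instance
  have hN' : (2:ℝ) ≤ N := by exact_mod_cast hN
  have hbp := ProbabilityTheory.beta_pos (α := N) (β := 1 - s) (by linarith) (by linarith)
  have hD0 : ∫⁻ x in ball (0 : EuclideanSpace ℝ (Fin N)) 1, ENNReal.ofReal ((1 - ‖x‖) ^ (-s)) ≠ 0 := by
    rw [ball_D hN s hs1]
    refine mul_ne_zero (by simpa using hbp) ?_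
    rw [Measure.measure_univ_ne_zero]
    exact Measure.toSphere_ne_zero _
  have ht : Tendsto (fun n : ℕ => ∫⁻ x in ball (0 : EuclideanSpace ℝ (Fin N)) 1, ENNReal.ofReal (uu N n x) * ENNReal.ofReal ((1 - ‖x‖) ^ (-s)))
      atTop (nhds (∫⁻ x in ball (0 : EuclideanSpace ℝ (Fin N)) 1, ENNReal.ofReal ((1 - ‖x‖) ^ (-s)))) := by
    refine lintegral_tendsto_of_tendsto_of_monotone ?_ ?_ ?_
    · intro n
      have := (uu_contDiff N n).continuous.measurable
      fun_prop
    · filter_upwards [ae_restrict_mem measurableSet_ball] with x hx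
      have hx1 : ‖x‖ < 1 := by simpa using hx
      have hx2 : 0 ≤ 1 - ‖x‖^2 := by nlinarith [norm_nonneg x]
      intro n m hnm
      beta_reduce
      gcongr
      exact Real.smoothTransition.monotone (by gcongr)
    · filter_upwards [ae_restrict_mem measurableSet_ball] with x hx
      have hx1 : ‖x‖ < 1 := by simpa using hx
      have hx2 : 0 < 1 - ‖x‖^2 := by nlinarith [norm_nonneg x]
      refine tendsto_const_nhds.congr' ?_
      obtain ⟨n0, hn0⟩ := exists_nat_ge (2 / (1 - ‖x‖^2))
      filter_upwards [eventually_ge_atTop n0] with n hn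
      have : uu N n x = 1 := by
        refine Real.smoothTransition.one_of_one_le ?_
        have h3 : (n0:ℝ) ≤ n := by exact_mod_cast hn
        have h4 : 2 / (1 - ‖x‖^2) ≤ n := hn0.trans h3
        rw [div_le_iff₀ hx2] at h4
        linarith
      rw [this, ENNReal.ofReal_one, one_mul]
  exact le_of_tendsto' (ENNReal.Tendsto.const_mul ht (Or.inl hD0)) (ball_test hN s hs hs1)

/-- upper bound for the sharp fractional Hardy constant of the unit ball in
terms of that of the half-space, for `N ≥ 2` and `s ∈ (0,1)`. -/
theorem hardy_ball_le (N : ℕ) (hN : 2 ≤ N) (s : ℝ) (hs : s ∈ Set.Ioo (0 : ℝ) 1) :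
    hardyConst N s 1 (Metric.ball (0 : EuclideanSpace ℝ (Fin N)) 1) ≤
      ENNReal.ofReal (Real.sqrt Real.pi /
          (Real.Gamma (1 - s / 2) * Real.Gamma (1 / 2 + s / 2)) *
          (Real.Gamma (((N : ℝ) + s) / 2) / Real.Gamma (((N : ℝ) - s) / 2)) *
          (Real.Gamma ((N : ℝ) - s) / Real.Gamma (N : ℝ))) *
        hardyConst N s 1 (halfSpace N (by omega)) := by
  obtain ⟨hs0, hs1⟩ := hs
  have : Nonempty (Fin N) := ⟨⟨0, by omega⟩⟩
  have : Nontrivial (EuclideanSpace ℝ (Fin N)) := by infer_instance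
  have hN' : (2:ℝ) ≤ N := by exact_mod_cast hN
  have hbp := ProbabilityTheory.beta_pos (α := N) (β := 1 - s) (by linarith) (by linarith)
  have hS0 : (volume : Measure (EuclideanSpace ℝ (Fin N))).toSphere univ ≠ 0 := by
    rw [Measure.measure_univ_ne_zero]
    exact Measure.toSphere_ne_zero _
  have hS1 : (volume : Measure (EuclideanSpace ℝ (Fin N))).toSphere univ ≠ ∞ := by finiteness
  have h1 := ball_up hN s hs0 hs1
  rw [ball_D hN s hs1, ← mul_assoc, ENNReal.mul_le_mul_iff_left hS0 hS1] at h1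
  have h2 := (ENNReal.le_div_iff_mul_le (Or.inl (by simpa using hbp)) (Or.inl (by finiteness))).2 h1
  refine h2.trans ?_
  refine le_trans ?_ (mul_le_mul_right (half_low hN (by omega) s hs0) _)
  have g1 : 0 < Real.Gamma (((N:ℝ) - s)/2) := Real.Gamma_pos_of_pos (by linarith)
  have g2 : 0 < Real.Gamma (((N:ℝ) + s)/2) := Real.Gamma_pos_of_pos (by linarith)
  have g3 : 0 < Real.Gamma ((N:ℝ) - s) := Real.Gamma_pos_of_pos (by linarith)
  have g4 : 0 < Real.Gamma (N:ℝ) := Real.Gamma_pos_of_pos (by linarith)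
  have g5 : 0 < Real.Gamma (1 - s / 2) := Real.Gamma_pos_of_pos (by linarith)
  have g6 : 0 < Real.Gamma ((1 + s) / 2) := Real.Gamma_pos_of_pos (by linarith)
  have g7 : 0 < Real.Gamma (1 - s) := Real.Gamma_pos_of_pos (by linarith)
  have g8 : 0 < Real.Gamma ((1 - s) / 2) := Real.Gamma_pos_of_pos (by linarith)
  have hp := Real.pi_pos
  have hNs : 0 < (N:ℝ) - s := by linarith
  rw [← ENNReal.ofReal_div_of_pos hbp, show 1 / 2 + s / 2 = (1 + s) / 2 by ring, ← ENNReal.ofReal_mul (by positivity)]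
  refine ENNReal.ofReal_le_ofReal (le_of_eq ?_)
  have e1 : Real.Gamma ((N:ℝ) + (1 - s)) = ((N:ℝ) - s) * Real.Gamma ((N:ℝ) - s) := by
    rw [← Real.Gamma_add_one hNs.ne']; congr 1; ring
  have e2 := Real.Gamma_mul_Gamma_add_half ((1 - s)/2)
  rw [show (1 - s)/2 + 1/2 = 1 - s/2 by ring, show 2 * ((1 - s)/2) = 1 - s by ring, show 1 - (1 - s) = s by ring] at e2
  have e3 : Real.Gamma ((1 - s)/2) = Real.Gamma (1 - s) * 2 ^ s * √Real.pi / Real.Gamma (1 - s/2) := by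
    rw [eq_div_iff g5.ne', e2]
  rw [ProbabilityTheory.beta, e1, e3, Real.rpow_neg (by norm_num)]
  have h2s : 0 < (2:ℝ) ^ s := by positivity
  generalize Real.pi ^ (((N:ℝ) - 1)/2) = P
  field_simp
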